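/- Let n ≥ 2, d ≥ 1, K ≥ 1, and let ρ be a density matrix on ℂ^d ⊗ ℂ^d. Suppose there exist dichotomic observables τ_1, …, τ_n on ℂ^d that pairwise anticommute, and dichotomic observables τ'_1, …, τ'_K on ℂ^d that pairwise anticommute, and suppose S := Σ_{y=1}^n Σ_{v=1}^K (Tr[(τ_y ⊗ τ'_v) ρ])² > 0. Then there exist dichotomic observables A_1, …, A_{2^{n−1}} and B_1, …, B_n on ℂ^d such that 𝓘_n(A, B, ρ) = 2^{n−1}·√S. (The construction takes each A_x to be a suitable real unit-norm linear combination of the τ_y and each B_y a real unit-norm linear combination of the τ'_v with coefficients proportional to the correlations Tr[(τ_y ⊗ τ'_v) ρ].) -/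

import Mathlib

open Matrix Kronecker BigOperators
open scoped ComplexOrder

noncomputable section

/-- A dichotomic observable: a Hermitian matrix squaring to the identity. -/
def IsDichotomic {I : Type} [Fintype I] [DecidableEq I] (O : Matrix I I ℂ) : Prop :=
  O.IsHermitian ∧ O * O = 1

/-- A density matrix: positive semidefinite with trace one. -/
def IsDensity {I : Type} [Fintype I] [DecidableEq I] (ρ : Matrix I I ℂ) : Prop :=
  ρ.PosSemidef ∧ ρ.trace = 1

/-- The sign `(-1)^{z_y^x}`, where `z_y^x` is the bit in position `n - y`
(here `y : Fin n` represents the setting `y+1`, `x : Fin (2^(n-1))` represents `x+1`,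
so the bit is that of `x` in position `n - 1 - y`). -/
def bellSign (n : ℕ) (y : Fin n) (x : Fin (2 ^ (n - 1))) : ℝ :=
  if (x : ℕ).testBit (n - 1 - (y : ℕ)) then -1 else 1

/-- The Bell value `𝓘_n(A, B, ρ) = Σ_y Σ_x (-1)^{z_y^x} Tr[(A_x ⊗ B_y) ρ]`. -/
def bellValue (n : ℕ) {IA IB : Type} [Fintype IA] [Fintype IB]
    (A : Fin (2 ^ (n - 1)) → Matrix IA IA ℂ) (B : Fin n → Matrix IB IB ℂ)
    (ρ : Matrix (IA × IB) (IA × IB) ℂ) : ℝ :=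
  ∑ y : Fin n, ∑ x : Fin (2 ^ (n - 1)), bellSign n y x * (((A x ⊗ₖ B y) * ρ).trace).re

/-- The local bound `L_n = (⌊n/2⌋+1)·C(n, ⌊n/2⌋+1)`. -/
def localBound (n : ℕ) : ℝ := ((n / 2 + 1) * Nat.choose n (n / 2 + 1) : ℕ)


/-- A real unit combination of pairwise anticommuting dichotomic observables is dichotomic. -/
lemma IsDichotomic.sum_smul {I ι : Type} [Fintype I] [DecidableEq I] [Fintype ι]
    {τ : ι → Matrix I I ℂ} (hτ : ∀ i, IsDichotomic (τ i))
    (hac : ∀ i j, i ≠ j → τ i * τ j + τ j * τ i = 0)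
    {a : ι → ℝ} (ha : ∑ i, a i ^ 2 = 1) : IsDichotomic (∑ i, a i • τ i) := by
  classical
  constructor
  · change (∑ i, a i • τ i)ᴴ = _
    rw [conjTranspose_sum]
    exact Finset.sum_congr rfl fun i _ => by rw [conjTranspose_smul, (hτ i).1.eq, star_trivial]
  · have hsq : (∑ i, a i • τ i) * (∑ i, a i • τ i) =
        ∑ i, ∑ j, (a i * a j) • (τ i * τ j) := by
      simp only [Finset.sum_mul_sum, smul_mul_smul_comm]
    have hdouble : (2 : ℝ) • ((∑ i, a i • τ i) * (∑ i, a i • τ i)) =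
        (2 : ℝ) • (1 : Matrix I I ℂ) := by
      calc (2 : ℝ) • ((∑ i, a i • τ i) * (∑ i, a i • τ i))
          = ∑ i, ∑ j, (a i * a j) • (τ i * τ j + τ j * τ i) := by
            simp only [smul_add, Finset.sum_add_distrib]
            rw [two_smul, hsq]
            congr 1
            rw [Finset.sum_comm]
            simp only [mul_comm]
        _ = ∑ i, (a i ^ 2) • ((2 : ℝ) • (1 : Matrix I I ℂ)) := by
            refine Finset.sum_congr rfl fun i _ => ?_
            rw [Finset.sum_eq_single i (fun j _ hj => by rw [hac i j hj.symm, smul_zero])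
              (by simp), (hτ i).2, pow_two, two_smul ℝ (1 : Matrix I I ℂ)]
        _ = _ := by rw [← Finset.sum_smul, ha, one_smul]
    exact smul_right_injective _ (two_ne_zero : (2 : ℝ) ≠ 0) hdouble

lemma trace_sum_smul_kronecker_sum_smul_re {I J ι κ : Type} [Fintype I] [Fintype J]
    [Fintype ι] [Fintype κ] (ρ : Matrix (I × J) (I × J) ℂ)
    (τ : ι → Matrix I I ℂ) (τ' : κ → Matrix J J ℂ) (a : ι → ℝ) (b : κ → ℝ) :
    ((((∑ i, a i • τ i) ⊗ₖ (∑ v, b v • τ' v)) * ρ).trace).re =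
      ∑ i, ∑ v, a i * b v * (((τ i ⊗ₖ τ' v) * ρ).trace).re := by
  have hexpand : (∑ i, a i • τ i) ⊗ₖ (∑ v, b v • τ' v) =
      ∑ i, ∑ v, (a i * b v) • (τ i ⊗ₖ τ' v) := by
    change kroneckerMapBilinear (LinearMap.mul ℝ ℂ) (∑ i, a i • τ i) (∑ v, b v • τ' v) = _
    simp only [map_sum, LinearMap.sum_apply, map_smul, LinearMap.smul_apply, Finset.smul_sum,
      smul_smul, mul_comm (b _)]
    exact Finset.sum_comm
  simp only [hexpand, Finset.sum_mul, trace_sum, Complex.re_sum, smul_mul, trace_smul,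
    Complex.smul_re, smul_eq_mul]

@[simp] lemma bellSign_mul_self (n : ℕ) (y : Fin n) (x : Fin (2 ^ (n - 1))) :
    bellSign n y x * bellSign n y x = 1 := by
  unfold bellSign
  split_ifs <;> norm_num

/-- The sign characters of two distinct bits are orthogonal: flipping bit `p` changes the sign of
each term. -/
lemma sum_testBit_sign_mul_eq_zero {m p q : ℕ} (hp : p < m) (hpq : p ≠ q) :
    ∑ x : Fin (2 ^ m), (if (x : ℕ).testBit p then (-1 : ℝ) else 1) *
      (if (x : ℕ).testBit q then (-1 : ℝ) else 1) = 0 := by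
  refine Finset.sum_involution
    (fun x _ => ⟨x ^^^ 2 ^ p, Nat.xor_lt_two_pow x.2 (Nat.pow_lt_pow_right one_lt_two hp)⟩)
    ?_ ?_ (fun _ _ => Finset.mem_univ _) ?_
  · intro x _
    simp only [Nat.testBit_xor, Nat.testBit_two_pow_self, Nat.testBit_two_pow_of_ne hpq,
      Bool.xor_false, Bool.xor_true]
    cases (x : ℕ).testBit p <;> cases (x : ℕ).testBit q <;> simp
  · intro x _ _ h
    have hbit := congrArg (fun z : Fin (2 ^ m) => (z : ℕ).testBit p) h
    simp at hbit
  · intro x _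
    ext
    simp

lemma sum_bellSign_mul_bellSign (n : ℕ) (y y' : Fin n) :
    ∑ x, bellSign n y x * bellSign n y' x = if y = y' then (2 : ℝ) ^ (n - 1) else 0 := by
  split_ifs with h
  · subst h
    simp
  · have hval : (y : ℕ) ≠ y' := fun e => h (Fin.ext e)
    have hy := y.2
    have hy' := y'.2
    unfold bellSign
    by_cases hp : n - 1 - (y : ℕ) < n - 1
    · exact sum_testBit_sign_mul_eq_zero hp (by omega)
    · simp only [mul_comm (ite ((Nat.testBit _ (n - 1 - (y : ℕ))) = true) (-1 : ℝ) 1)]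
      exact sum_testBit_sign_mul_eq_zero (by omega) (by omega)

/-- Some unit vector has inner product with `c` equal to the Euclidean norm of `c`. -/
lemma exists_unit_sum_mul_eq_sqrt {κ : Type} [Fintype κ] [Nonempty κ] (c : κ → ℝ) :
    ∃ b : κ → ℝ, ∑ v, b v ^ 2 = 1 ∧ ∑ v, b v * c v = √(∑ v, c v ^ 2) := by
  classical
  have hnonneg : 0 ≤ ∑ v, c v ^ 2 := Finset.sum_nonneg fun v _ => sq_nonneg (c v)
  rcases hnonneg.eq_or_lt with h | h
  · have hc : ∀ v, c v = 0 := fun v => by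
      simpa using (Finset.sum_eq_zero_iff_of_nonneg fun v _ => sq_nonneg (c v)).1 h.symm v
    exact ⟨Pi.single (Classical.arbitrary κ) 1, by simp [Pi.single_apply], by simp [hc]⟩
  · have hr := Real.sqrt_pos.2 h
    refine ⟨fun v => c v / √(∑ v, c v ^ 2), ?_, ?_⟩
    · simp only [div_pow, ← Finset.sum_div, Real.sq_sqrt hnonneg]
      exact div_self h.ne'
    · simp only [div_mul_eq_mul_div, ← Finset.sum_div, ← pow_two]
      rw [div_eq_iff hr.ne', Real.mul_self_sqrt hnonneg]

/-- given `n` pairwise anticommuting dichotomic `τ` and `K` pairwise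
anticommuting dichotomic `τ'` with `S := Σ_{y,v} Tr[(τ_y ⊗ τ'_v) ρ]² > 0`, there exist
dichotomic observables attaining the Bell value `2^{n-1}·√S`. -/
theorem bell_value_attained
    (n d K : ℕ) (hn : 2 ≤ n) (hd : 1 ≤ d) (hK : 1 ≤ K)
    (ρ : Matrix (Fin d × Fin d) (Fin d × Fin d) ℂ) (hρ : IsDensity ρ)
    (τ : Fin n → Matrix (Fin d) (Fin d) ℂ) (hτ : ∀ y, IsDichotomic (τ y))
    (hτac : ∀ y y', y ≠ y' → τ y * τ y' + τ y' * τ y = 0)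
    (τ' : Fin K → Matrix (Fin d) (Fin d) ℂ) (hτ' : ∀ v, IsDichotomic (τ' v))
    (hτ'ac : ∀ v v', v ≠ v' → τ' v * τ' v' + τ' v' * τ' v = 0)
    (hS : 0 < ∑ y : Fin n, ∑ v : Fin K, ((((τ y ⊗ₖ τ' v) * ρ).trace).re) ^ 2) :
    ∃ (A : Fin (2 ^ (n - 1)) → Matrix (Fin d) (Fin d) ℂ)
      (B : Fin n → Matrix (Fin d) (Fin d) ℂ),
      (∀ x, IsDichotomic (A x)) ∧ (∀ y, IsDichotomic (B y)) ∧
      bellValue n A B ρ = (2 : ℝ) ^ (n - 1) *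
        Real.sqrt (∑ y : Fin n, ∑ v : Fin K, ((((τ y ⊗ₖ τ' v) * ρ).trace).re) ^ 2) := by
  set c : Fin n → Fin K → ℝ := fun y v => (((τ y ⊗ₖ τ' v) * ρ).trace).re with hc
  set S : ℝ := ∑ y, ∑ v, c y v ^ 2 with hSdef
  have : Nonempty (Fin K) := ⟨⟨0, hK⟩⟩
  choose b hb hbc using fun y => exists_unit_sum_mul_eq_sqrt (c y)
  set r : Fin n → ℝ := fun y => √(∑ v, c y v ^ 2) with hr
  have hrsq : ∑ y, r y ^ 2 = S :=
    Finset.sum_congr rfl fun y _ => Real.sq_sqrt (Finset.sum_nonneg fun v _ => sq_nonneg _)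
  refine ⟨fun x => ∑ y, (bellSign n y x * (r y / √S)) • τ y, fun y => ∑ v, b y v • τ' v,
    fun x => IsDichotomic.sum_smul hτ hτac ?_,
    fun y => IsDichotomic.sum_smul hτ' hτ'ac (hb y), ?_⟩
  · simp only [mul_pow, div_pow, pow_two (bellSign _ _ _), bellSign_mul_self, one_mul,
      ← Finset.sum_div, hrsq, Real.sq_sqrt hS.le]
    exact div_self hS.ne'
  · have hterm (y : Fin n) : ∑ x, bellSign n y x * ((((∑ y', (bellSign n y' x * (r y' / √S)) •
        τ y') ⊗ₖ (∑ v, b y v • τ' v)) * ρ).trace).re = 2 ^ (n - 1) * (r y ^ 2 / √S) := by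
      calc _ = ∑ y', (∑ x, bellSign n y x * bellSign n y' x) *
            (r y' / √S * ∑ v, b y v * c y' v) := by
            simp only [trace_sum_smul_kronecker_sum_smul_re, Finset.sum_mul, Finset.mul_sum]
            rw [Finset.sum_comm]
            refine Finset.sum_congr rfl fun y' _ => ?_
            conv_rhs => rw [Finset.sum_comm]
            refine Finset.sum_congr rfl fun x _ => Finset.sum_congr rfl fun v _ => ?_
            simp only [hc]
            ring
        _ = _ := by
            simp only [sum_bellSign_mul_bellSign, ite_mul, zero_mul, Finset.sum_ite_eq,
              Finset.mem_univ, if_true, hbc]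
            ring
    unfold bellValue
    simp only [hterm]
    rw [← Finset.mul_sum, ← Finset.sum_div, hrsq, Real.div_sqrt]
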